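/- Let u and v be fuzzy numbers and let α ∈ [0,1]. If the left derivatives satisfy u'₋(u⁻(α)) = φ > 0 and v'₋(v⁻(α)) = ψ > 0, then the left derivative of u∇v at (u∇v)⁻(α) equals (φ⁻¹ + ψ⁻¹)⁻¹, i.e., (u∇v)'₋((u∇v)⁻(α)) = (φ⁻¹ + ψ⁻¹)⁻¹. -/

import Mathlib

open Set Filter Topology

/-- A fuzzy number: a function `ℝ → ℝ` taking values in `[0,1]`, whose `α`-cuts
(for `α ∈ (0,1]`) and whose `0`-cut (the closure of the support) are nonempty
compact intervals. -/
structure FuzzyNumber where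
  f : ℝ → ℝ
  mem_Icc : ∀ x, f x ∈ Set.Icc (0 : ℝ) 1
  cut_isIcc : ∀ α ∈ Set.Ioc (0 : ℝ) 1, ∃ a b : ℝ, a ≤ b ∧ {x | α ≤ f x} = Set.Icc a b
  supp_isIcc : ∃ a b : ℝ, a ≤ b ∧ closure {x | 0 < f x} = Set.Icc a b

namespace FuzzyNumber

/-- The `α`-cut of a fuzzy number; for `α = 0` it is the closure of the support. -/
noncomputable def cut (u : FuzzyNumber) (α : ℝ) : Set ℝ :=
  if α = 0 then closure {x | 0 < u.f x} else {x | α ≤ u.f x}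

/-- Left endpoint `u⁻(α)` of the `α`-cut. -/
noncomputable def lo (u : FuzzyNumber) (α : ℝ) : ℝ := sInf (u.cut α)

/-- Right endpoint `u⁺(α)` of the `α`-cut. -/
noncomputable def hi (u : FuzzyNumber) (α : ℝ) : ℝ := sSup (u.cut α)

/-- Left endpoint `u_s⁻(α)` of the strong `α`-cut: `lim_{β→α⁺} u⁻(β)` for `α < 1`,
and `u⁻(1)` for `α = 1`.  Since `u⁻` is nondecreasing, this right limit is the
infimum of `u⁻` over `(α,1]`. -/
noncomputable def slo (u : FuzzyNumber) (α : ℝ) : ℝ :=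
  if α < 1 then sInf (u.lo '' Set.Ioc α 1) else u.lo 1

/-- Right endpoint `u_s⁺(α)` of the strong `α`-cut: `lim_{β→α⁺} u⁺(β)` for `α < 1`,
and `u⁺(1)` for `α = 1`. -/
noncomputable def shi (u : FuzzyNumber) (α : ℝ) : ℝ :=
  if α < 1 then sSup (u.hi '' Set.Ioc α 1) else u.hi 1

/-- The sup-min convolution `u∇v` of two fuzzy numbers, as a function on `ℝ`:
`(u∇v)(x) = sup_y min (u y) (v (x - y))`.  Its cut functions satisfy
`(u∇v)⁻(α) = u⁻(α) + v⁻(α)` and `(u∇v)⁺(α) = u⁺(α) + v⁺(α)`. -/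
noncomputable def conv (u v : FuzzyNumber) (x : ℝ) : ℝ :=
  ⨆ y : ℝ, min (u.f y) (v.f (x - y))

end FuzzyNumber

/-- `f` has left derivative `f'` at `x`. -/
def HasLeftDerivAt (f : ℝ → ℝ) (f' x : ℝ) : Prop :=
  HasDerivWithinAt f f' (Set.Iio x) x

/-- `f` has right derivative `f'` at `x`. -/
def HasRightDerivAt (f : ℝ → ℝ) (f' x : ℝ) : Prop :=
  HasDerivWithinAt f f' (Set.Ioi x) x

namespace FuzzyNumber

lemma lo_isLeast_cut (u : FuzzyNumber) {α : ℝ} (hα : α ∈ Set.Ioc (0 : ℝ) 1) :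
    IsLeast {x | α ≤ u.f x} (u.lo α) := by
  obtain ⟨a, b, hab, h⟩ := u.cut_isIcc α hα
  rw [lo, cut, if_neg hα.1.ne', h, csInf_Icc hab]
  exact isLeast_Icc hab

lemma eq_zero_of_lt_lo_zero (u : FuzzyNumber) {x : ℝ} (hx : x < u.lo 0) : u.f x = 0 := by
  obtain ⟨a, b, hab, h⟩ := u.supp_isIcc
  rw [lo, cut, if_pos rfl, h, csInf_Icc hab] at hx
  by_contra hne
  have hmem : x ∈ closure {x | 0 < u.f x} :=
    subset_closure ((u.mem_Icc x).1.lt_of_ne' hne)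
  rw [h] at hmem
  exact hx.not_ge hmem.1

lemma lt_of_lt_lo (u : FuzzyNumber) {α x : ℝ} (hα : α ∈ Set.Ioc (0 : ℝ) 1)
    (hx : x < u.lo α) : u.f x < α := by
  by_contra! h
  exact hx.not_ge ((u.lo_isLeast_cut hα).2 h)

lemma monotoneOn_Iic_lo (u : FuzzyNumber) {α : ℝ} (hα : α ∈ Set.Ioc (0 : ℝ) 1) :
    MonotoneOn u.f (Set.Iic (u.lo α)) := by
  intro x hx y hy hxy
  rcases (u.mem_Icc x).1.eq_or_lt with h0 | h0
  · exact h0 ▸ (u.mem_Icc y).1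
  have hle : u.f x ≤ u.f (u.lo α) := by
    rcases (Set.mem_Iic.1 hx).eq_or_lt with h | h
    · rw [h]
    · exact (u.lt_of_lt_lo hα h).le.trans (u.lo_isLeast_cut hα).1
  obtain ⟨a, b, -, h⟩ := u.cut_isIcc (u.f x) ⟨h0, (u.mem_Icc x).2⟩
  have hxm : x ∈ Set.Icc a b := h ▸ le_refl (u.f x)
  have hlm : u.lo α ∈ Set.Icc a b := h ▸ hle
  have hym : y ∈ {z | u.f x ≤ u.f z} := h ▸ ⟨hxm.1.trans hxy, le_trans hy hlm.2⟩
  exact hym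

lemma bddAbove_range_min (u v : FuzzyNumber) (x : ℝ) :
    BddAbove (Set.range fun y => min (u.f y) (v.f (x - y))) :=
  ⟨1, by rintro _ ⟨y, rfl⟩; exact (min_le_left _ _).trans (u.mem_Icc y).2⟩

lemma min_le_conv (u v : FuzzyNumber) (s t : ℝ) : min (u.f s) (v.f t) ≤ u.conv v (s + t) := by
  simpa [conv] using le_ciSup (u.bddAbove_range_min v (s + t)) s

lemma conv_le_max (u v : FuzzyNumber) {a b s t : ℝ} (hu : MonotoneOn u.f (Set.Iic a))
    (hv : MonotoneOn v.f (Set.Iic b)) (hs : s ≤ a) (ht : t ≤ b) :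
    u.conv v (s + t) ≤ max (u.f s) (v.f t) := by
  refine ciSup_le fun y => ?_
  rcases le_total y s with h | h
  · exact (min_le_left _ _).trans ((hu (h.trans hs) hs h).trans (le_max_left _ _))
  · have h' : s + t - y ≤ t := by linarith
    exact (min_le_right _ _).trans ((hv (h'.trans ht) ht h').trans (le_max_right _ _))

lemma f_lo_eq (u : FuzzyNumber) {α : ℝ} (hα : α ∈ Set.Ioc (0 : ℝ) 1)
    (h : ContinuousWithinAt u.f (Set.Iio (u.lo α)) (u.lo α)) : u.f (u.lo α) = α :=
  le_antisymm
    (le_of_tendsto h (eventually_mem_nhdsWithin.mono fun _ hx => (u.lt_of_lt_lo hα hx).le))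
    (u.lo_isLeast_cut hα).1

lemma leftDeriv_lo_zero (u : FuzzyNumber) {φ : ℝ} (h : HasLeftDerivAt u.f φ (u.lo 0)) :
    φ = 0 := by
  have hz : ∀ x ∈ Set.Iio (u.lo 0), u.f x = 0 := fun x hx => u.eq_zero_of_lt_lo_zero hx
  have hlo : u.f (u.lo 0) = 0 :=
    tendsto_nhds_unique h.continuousWithinAt
      (tendsto_const_nhds.congr' (eventually_mem_nhdsWithin.mono fun x hx => (hz x hx).symm))
  exact (uniqueDiffWithinAt_Iio _).eq_deriv _ h
    ((hasDerivWithinAt_const _ _ (0 : ℝ)).congr hz hlo)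

end FuzzyNumber

lemma hasDerivWithinAt_of_min_le_of_le_max {f p q : ℝ → ℝ} {s : Set ℝ} {c d : ℝ}
    (hp : HasDerivWithinAt p d s c) (hq : HasDerivWithinAt q d s c) (hpc : p c = f c)
    (hqc : q c = f c) (hmin : ∀ x ∈ s, min (p x) (q x) ≤ f x)
    (hmax : ∀ x ∈ s, f x ≤ max (p x) (q x)) : HasDerivWithinAt f d s c := by
  rw [hasDerivWithinAt_iff_isLittleO] at *
  refine (Asymptotics.IsBigO.of_bound' ?_).trans_isLittleO (hp.norm_left.add hq.norm_left)
  filter_upwards [eventually_mem_nhdsWithin] with x hx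
  rw [hpc, hqc]
  simp only [Real.norm_eq_abs]
  refine le_trans ?_ (le_abs_self _)
  have h₁ := hmin x hx
  have h₂ := hmax x hx
  grind

lemma HasLeftDerivAt.comp_affine {f : ℝ → ℝ} {f' a k c : ℝ} (h : HasLeftDerivAt f f' a)
    (hk : 0 < k) : HasLeftDerivAt (fun x => f (a + k * (x - c))) (f' * k) c := by
  have hin : HasDerivWithinAt (fun x => a + k * (x - c)) k (Set.Iio c) c := by
    simpa using ((((hasDerivAt_id c).sub_const c).const_mul k).const_add a).hasDerivWithinAt
  have hf : HasDerivWithinAt f f' (Set.Iio a) (a + k * (c - c)) := by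
    rwa [sub_self, mul_zero, add_zero]
  refine hf.comp c hin fun x hx => ?_
  have := mul_neg_of_pos_of_neg hk (sub_neg.2 hx)
  simpa using this

/-- Theorem `dbzeron`(i): if `u'₋(u⁻(α)) = φ > 0` and
`v'₋(v⁻(α)) = ψ > 0`, then `(u∇v)'₋((u∇v)⁻(α)) = (φ⁻¹ + ψ⁻¹)⁻¹`. -/
theorem conv_leftDeriv_harmonic (u v : FuzzyNumber) (α φ ψ : ℝ)
    (hα : α ∈ Set.Icc (0 : ℝ) 1) (hφ : 0 < φ) (hψ : 0 < ψ)
    (hu : HasLeftDerivAt u.f φ (u.lo α)) (hv : HasLeftDerivAt v.f ψ (v.lo α)) :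
    HasLeftDerivAt (u.conv v) (φ⁻¹ + ψ⁻¹)⁻¹ (u.lo α + v.lo α) := by
  rcases hα.1.eq_or_lt with rfl | h0
  · exact absurd (u.leftDeriv_lo_zero hu) hφ.ne'
  have hα' : α ∈ Set.Ioc (0 : ℝ) 1 := ⟨h0, hα.2⟩
  have hmu := u.monotoneOn_Iic_lo hα'
  have hmv := v.monotoneOn_Iic_lo hα'
  have hua := u.f_lo_eq hα' hu.continuousWithinAt
  have hvb := v.f_lo_eq hα' hv.continuousWithinAt
  set a := u.lo α
  set b := v.lo α
  set χ := (φ⁻¹ + ψ⁻¹)⁻¹ with hχ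
  have hχ0 : 0 < χ := by positivity
  have hsum : χ / φ + χ / ψ = 1 := by
    rw [hχ]; field_simp
  have hsplit (x : ℝ) :
      a + χ / φ * (x - (a + b)) + (b + χ / ψ * (x - (a + b))) = x := by
    linear_combination (x - (a + b)) * hsum
  have hmin (x : ℝ) := u.min_le_conv v (a + χ / φ * (x - (a + b))) (b + χ / ψ * (x - (a + b)))
  have hmax (x : ℝ) (hx : x ≤ a + b) :=
    u.conv_le_max v hmu hmv
      (add_le_of_nonpos_right
        (mul_nonpos_of_nonneg_of_nonpos (div_pos hχ0 hφ).le (sub_nonpos.2 hx)))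
      (add_le_of_nonpos_right
        (mul_nonpos_of_nonneg_of_nonpos (div_pos hχ0 hψ).le (sub_nonpos.2 hx)))
  simp only [hsplit] at hmin hmax
  have hc : u.conv v (a + b) = α :=
    le_antisymm (by simpa [hua, hvb] using hmax (a + b) le_rfl)
      (by simpa [hua, hvb] using hmin (a + b))
  have hp := hu.comp_affine (c := a + b) (div_pos hχ0 hφ)
  have hq := hv.comp_affine (c := a + b) (div_pos hχ0 hψ)
  rw [mul_div_cancel₀ _ hφ.ne'] at hp
  rw [mul_div_cancel₀ _ hψ.ne'] at hq
  exact hasDerivWithinAt_of_min_le_of_le_max hp hq (by simp [hua, hc]) (by simp [hvb, hc])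
    (fun x _ => hmin x) fun x hx => hmax x (le_of_lt hx)
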